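/- arXiv:2204.00066 — 3 statements merged into one kernel-verified Lean document; each statement's English description precedes it below -/
import Mathlib

section
/- For every positive integer n and every partition λ of n, there exists a polynomial P_λ ∈ ℤ[x] such that for every finite field F, the number of strictly upper triangular n×n matrices over F of Jordan type λ equals P_λ evaluated at the cardinality |F|. -/
open Polynomial

/-- `f` represents the partition `λ₁ ≥ λ₂ ≥ … ≥ λ_N > 0` of `n`:
`f i = λᵢ` for `1 ≤ i ≤ N` and `f i = 0` for `i > N`. -/
def IsPartitionFun (f : ℕ → ℕ) (n N : ℕ) : Prop :=
  (∀ i j, i ≤ j → f j ≤ f i) ∧ (∀ i, 1 ≤ i → (0 < f i ↔ i ≤ N)) ∧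
    ∑ i ∈ Finset.Icc 1 N, f i = n

/-- `A` is strictly upper triangular: `A i j = 0` whenever `j ≤ i`. -/
def StrictUpper {m : ℕ} {F : Type*} [Zero F] (A : Matrix (Fin m) (Fin m) F) : Prop :=
  ∀ i j : Fin m, (j : ℕ) ≤ (i : ℕ) → A i j = 0

/-- `A` has Jordan type `λ`: `rank (A ^ k) = Σᵢ max (λᵢ - k) 0` for every `k ≥ 0`. -/
def HasJordanType {m : ℕ} {F : Type*} [Field F] (A : Matrix (Fin m) (Fin m) F)
    (f : ℕ → ℕ) (N : ℕ) : Prop :=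
  ∀ k : ℕ, (A ^ k).rank = ∑ i ∈ Finset.Icc 1 N, (f i - k)

/-- The number of strictly upper triangular `m × m` matrices over `F` of Jordan type `λ`. -/
noncomputable def jordanCount (m : ℕ) (f : ℕ → ℕ) (N : ℕ)
    (F : Type) [Field F] [Fintype F] : ℕ :=
  Nat.card {A : Matrix (Fin m) (Fin m) F // StrictUpper A ∧ HasJordanType A f N}

/-- `dualPart f N j = λ'_j`, the number of parts of `λ` that are `≥ j`. -/
def dualPart (f : ℕ → ℕ) (N j : ℕ) : ℕ :=
  ((Finset.Icc 1 N).filter fun i => j ≤ f i).card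

/-- `alphaCount f N k = α_k`, the number of parts of `λ` equal to `k`. -/
def alphaCount (f : ℕ → ℕ) (N k : ℕ) : ℕ :=
  ((Finset.Icc 1 N).filter fun i => f i = k).card

/-- The rows containing a removable cell of the Young diagram of `λ`:
rows `1 ≤ i ≤ N` with `i = N` or `λ_{i+1} < λᵢ` (for `i = N` the condition
`f (i+1) < f i` holds automatically since `f (N+1) = 0 < f N`). -/
def removables (f : ℕ → ℕ) (N : ℕ) : Finset ℕ :=
  (Finset.Icc 1 N).filter fun i => f (i + 1) < f i

open Matrix in
theorem Matrix.fromBlocks_zero_zero_pow_succ {m l F : Type*} [Fintype m] [DecidableEq m]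
    [Fintype l] [DecidableEq l] [CommSemiring F] (B : Matrix m m F) (C : Matrix m l F) (k : ℕ) :
    (fromBlocks B C 0 0 : Matrix (m ⊕ l) (m ⊕ l) F) ^ (k + 1) =
      fromBlocks (B ^ (k + 1)) (B ^ k * C) 0 0 := by
  induction k with
  | zero => simp
  | succ k ih =>
    rw [pow_succ', ih, fromBlocks_multiply]
    simp [← pow_succ', ← Matrix.mul_assoc]

open Matrix in
/-- The rank of a matrix extended by one column is governed by the span of its columns. -/
theorem Matrix.rank_fromBlocks_replicateCol {m F : Type*} [Fintype m] [DecidableEq m]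
    [Field F] (X : Matrix m m F) (y : m → F) :
    (fromBlocks X (replicateCol (Fin 1) y) 0 0 : Matrix (m ⊕ Fin 1) (m ⊕ Fin 1) F).rank =
      Module.finrank F ↥(X.mulVecLin.range ⊔ Submodule.span F {y}) := by
  let e : (m → F) →ₗ[F] (m ⊕ Fin 1 → F) :=
    (LinearEquiv.sumArrowLequivProdArrow m (Fin 1) F F).symm.toLinearMap ∘ₗ
      LinearMap.inl F (m → F) (Fin 1 → F)
  have e_apply : ∀ u, e u = Sum.elim u 0 := by
    intro u
    ext i
    cases i <;> simp [e]
  have he : Function.Injective e := by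
    intro u w h
    ext i
    simpa [e_apply] using congrFun h (Sum.inl i)
  have hmul : ∀ u c, fromBlocks X (replicateCol (Fin 1) y) 0 0 *ᵥ Sum.elim u c =
      e (X *ᵥ u + c 0 • y) := by
    intro u c
    rw [fromBlocks_mulVec, e_apply]
    ext i
    cases i <;> simp [mulVec, dotProduct, mul_comm]
  suffices h : (fromBlocks X (replicateCol (Fin 1) y) 0 0).mulVecLin.range =
      (X.mulVecLin.range ⊔ Submodule.span F {y}).map e by
    rw [Matrix.rank, h, (Submodule.equivMapOfInjective e he _).finrank_eq]
  ext w
  simp only [LinearMap.mem_range, Submodule.mem_map, Submodule.mem_sup,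
    Submodule.mem_span_singleton, mulVecLin_apply]
  constructor
  · rintro ⟨u, rfl⟩
    rw [← Sum.elim_comp_inl_inr u, hmul]
    exact ⟨_, ⟨_, ⟨_, rfl⟩, _, ⟨_, rfl⟩, rfl⟩, rfl⟩
  · rintro ⟨_, ⟨_, ⟨u, rfl⟩, _, ⟨c, rfl⟩, rfl⟩, rfl⟩
    exact ⟨Sum.elim u fun _ => c, hmul u _⟩

/-- Extend a square matrix by a last column `v` (with a zero corner) and a zero last row. -/
def appendCol {m : ℕ} {F : Type*} [Zero F] (B : Matrix (Fin m) (Fin m) F) (v : Fin m → F) :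
    Matrix (Fin (m + 1)) (Fin (m + 1)) F :=
  Matrix.reindex finSumFinEquiv finSumFinEquiv
    (Matrix.fromBlocks B (Matrix.replicateCol (Fin 1) v) 0 0)

/-- The vectors `v` for which `B ^ j v` lies in the range of `B ^ (j + 1)`. -/
def returnSpace {m : ℕ} {F : Type*} [Field F] (B : Matrix (Fin m) (Fin m) F) (j : ℕ) :
    Submodule F (Fin m → F) :=
  (B ^ (j + 1)).mulVecLin.range.comap (B ^ j).mulVecLin

theorem returnSpace_mono {m : ℕ} {F : Type*} [Field F] (B : Matrix (Fin m) (Fin m) F) :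
    Monotone (returnSpace B) := by
  refine monotone_nat_of_le_succ fun j v hv => ?_
  obtain ⟨w, hw⟩ := hv
  refine ⟨w, ?_⟩
  simp only [Matrix.mulVecLin_apply] at hw ⊢
  rw [pow_succ' B (j + 1), ← Matrix.mulVec_mulVec, hw, Matrix.mulVec_mulVec, ← pow_succ']

theorem finrank_returnSpace {m : ℕ} {F : Type*} [Field F] (B : Matrix (Fin m) (Fin m) F)
    (j : ℕ) :
    Module.finrank F (returnSpace B j) = (B ^ (j + 1)).rank + (m - (B ^ j).rank) := by
  have hle : (B ^ (j + 1)).mulVecLin.range ≤ (B ^ j).mulVecLin.range := by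
    rintro _ ⟨w, rfl⟩
    exact ⟨B.mulVec w, by simp [Matrix.mulVec_mulVec, pow_succ]⟩
  have h1 := (B ^ j).mulVecLin.finrank_range_add_finrank_ker
  have h2 := ((B ^ j).mulVecLin.domRestrict (returnSpace B j)).finrank_range_add_finrank_ker
  have hker : (B ^ j).mulVecLin.ker ≤ returnSpace B j := by
    intro v hv
    rw [LinearMap.mem_ker] at hv
    rw [returnSpace, Submodule.mem_comap, hv]
    exact zero_mem _
  have h3 : Module.finrank F ((B ^ j).mulVecLin.domRestrict (returnSpace B j)).ker =
      Module.finrank F (B ^ j).mulVecLin.ker := by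
    rw [LinearMap.ker_domRestrict]
    exact (Submodule.comapSubtypeEquivOfLe hker).finrank_eq
  have h4 : ((B ^ j).mulVecLin.domRestrict (returnSpace B j)).range =
      (B ^ (j + 1)).mulVecLin.range := by
    rw [LinearMap.range_domRestrict, returnSpace, Submodule.map_comap_eq, inf_eq_right.2 hle]
  rw [h3, h4] at h2
  rw [Module.finrank_fin_fun] at h1
  simp only [Matrix.rank]
  omega

theorem rank_appendCol_pow_succ {m : ℕ} {F : Type*} [Field F] (B : Matrix (Fin m) (Fin m) F)
    (v : Fin m → F) (k : ℕ) [Decidable (v ∈ returnSpace B k)] :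
    (appendCol B v ^ (k + 1)).rank =
      (B ^ (k + 1)).rank + if v ∈ returnSpace B k then 0 else 1 := by
  have hpow : appendCol B v ^ (k + 1) = Matrix.reindex finSumFinEquiv finSumFinEquiv
      (Matrix.fromBlocks (B ^ (k + 1)) (Matrix.replicateCol (Fin 1) ((B ^ k).mulVec v)) 0 0) := by
    have := map_pow (Matrix.reindexAlgEquiv F F (finSumFinEquiv (m := m) (n := 1)))
      (Matrix.fromBlocks B (Matrix.replicateCol (Fin 1) v) 0 0) (k + 1)
    rw [Matrix.fromBlocks_zero_zero_pow_succ] at this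
    rw [Matrix.replicateCol_mulVec]
    exact this.symm
  rw [hpow, Matrix.rank_reindex, Matrix.rank_fromBlocks_replicateCol]
  split_ifs with h
  · rw [sup_eq_left.2]
    · rfl
    · rw [Submodule.span_singleton_le_iff_mem]
      exact h
  · rw [Submodule.finrank_sup_span_singleton]
    · rfl
    · exact h

theorem StrictUpper.pow_apply_eq_zero {m : ℕ} {F : Type*} [Field F]
    {B : Matrix (Fin m) (Fin m) F} (hB : StrictUpper B) (k : ℕ) (i j : Fin m)
    (hij : (j : ℕ) < i + k) : (B ^ k) i j = 0 := by
  induction k generalizing j with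
  | zero =>
    rw [pow_zero, Matrix.one_apply_ne]
    rintro rfl
    omega
  | succ k ih =>
    rw [pow_succ, Matrix.mul_apply]
    refine Finset.sum_eq_zero fun l _ => ?_
    by_cases hl : (l : ℕ) < i + k
    · rw [ih l hl, zero_mul]
    · rw [hB l j (by omega), mul_zero]

theorem StrictUpper.pow_eq_zero {m : ℕ} {F : Type*} [Field F]
    {B : Matrix (Fin m) (Fin m) F} (hB : StrictUpper B) : B ^ m = 0 := by
  ext i j
  exact hB.pow_apply_eq_zero m i j (by omega)

theorem StrictUpper.mem_returnSpace {m : ℕ} {F : Type*} [Field F]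
    {B : Matrix (Fin m) (Fin m) F} (hB : StrictUpper B) (v : Fin m → F) :
    v ∈ returnSpace B m := by
  rw [returnSpace, Submodule.mem_comap, hB.pow_eq_zero]
  simp

/-- The least `j` such that `v ∈ returnSpace B j`. -/
noncomputable def returnTime {m : ℕ} {F : Type*} [Field F] (B : Matrix (Fin m) (Fin m) F)
    (v : Fin m → F) : ℕ :=
  sInf {j | v ∈ returnSpace B j}

theorem StrictUpper.returnTime_le_iff {m : ℕ} {F : Type*} [Field F]
    {B : Matrix (Fin m) (Fin m) F} (hB : StrictUpper B) (v : Fin m → F) (j : ℕ) :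
    returnTime B v ≤ j ↔ v ∈ returnSpace B j := by
  constructor
  · intro h
    have : v ∈ returnSpace B (returnTime B v) :=
      Nat.sInf_mem (s := {j | v ∈ returnSpace B j}) ⟨m, hB.mem_returnSpace v⟩
    exact returnSpace_mono B h this
  · exact fun h => Nat.sInf_le h

theorem StrictUpper.rank_appendCol_pow {m : ℕ} {F : Type*} [Field F]
    {B : Matrix (Fin m) (Fin m) F} (hB : StrictUpper B) (v : Fin m → F) (k : ℕ) :
    (appendCol B v ^ k).rank = (B ^ k).rank + if k ≤ returnTime B v then 1 else 0 := by
  classical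
  cases k with
  | zero => simp [Matrix.rank_one]
  | succ k =>
    rw [rank_appendCol_pow_succ]
    simp only [← hB.returnTime_le_iff v k]
    split_ifs <;> first | rfl | omega

open Classical in
theorem StrictUpper.card_returnTime_le {m : ℕ} {F : Type*} [Field F] [Fintype F]
    {B : Matrix (Fin m) (Fin m) F} (hB : StrictUpper B) (j : ℕ) :
    (Finset.univ.filter fun v => returnTime B v ≤ j).card =
      Fintype.card F ^ ((B ^ (j + 1)).rank + (m - (B ^ j).rank)) := by
  rw [← finrank_returnSpace, ← Module.card_eq_pow_finrank, Fintype.card_subtype]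
  simp only [hB.returnTime_le_iff]

/-- The polynomial counting the vectors of return time `j` for a matrix
whose powers have ranks `r`. -/
noncomputable def returnPoly (m : ℕ) (r : ℕ → ℕ) : ℕ → ℤ[X]
  | 0 => X ^ (r 1 + (m - r 0))
  | j + 1 => X ^ (r (j + 2) + (m - r (j + 1))) - X ^ (r (j + 1) + (m - r j))

open Classical in
theorem StrictUpper.card_returnTime_eq {m : ℕ} {F : Type*} [Field F] [Fintype F]
    {B : Matrix (Fin m) (Fin m) F} (hB : StrictUpper B) (j : ℕ) :
    ((Finset.univ.filter fun v => returnTime B v = j).card : ℤ) =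
      (returnPoly m (fun k => (B ^ k).rank) j).eval (Fintype.card F : ℤ) := by
  cases j with
  | zero =>
    have := hB.card_returnTime_le 0
    simp only [Nat.le_zero] at this
    rw [this]
    simp [returnPoly]
  | succ j =>
    have hsplit : (Finset.univ.filter fun v => returnTime B v ≤ j + 1) =
        (Finset.univ.filter fun v => returnTime B v ≤ j) ∪
          (Finset.univ.filter fun v => returnTime B v = j + 1) := by
      ext v
      simp only [Finset.mem_filter, Finset.mem_univ, true_and, Finset.mem_union]
      omega
    have hdisj : Disjoint (Finset.univ.filter fun v => returnTime B v ≤ j)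
        (Finset.univ.filter fun v => returnTime B v = j + 1) := by
      rw [Finset.disjoint_filter]
      intros
      omega
    have hcard := congrArg Finset.card hsplit
    rw [Finset.card_union_of_disjoint hdisj, hB.card_returnTime_le,
      hB.card_returnTime_le] at hcard
    have hcard' := congrArg (Nat.cast : ℕ → ℤ) hcard
    push_cast at hcard'
    simp only [returnPoly, eval_sub, eval_pow, eval_X]
    linarith

theorem strictUpper_appendCol {m : ℕ} {F : Type*} [Field F] {B : Matrix (Fin m) (Fin m) F}
    {v : Fin m → F} : StrictUpper (appendCol B v) ↔ StrictUpper B := by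
  constructor
  · intro h i j hij
    simpa [appendCol] using h (Fin.castAdd 1 i) (Fin.castAdd 1 j) (by simpa using hij)
  · intro h i j hij
    induction i using Fin.addCases with
    | left i =>
      induction j using Fin.addCases with
      | left j => simpa [appendCol] using h i j (by simpa using hij)
      | right j =>
        simp only [Fin.val_natAdd, Fin.val_castAdd] at hij
        omega
    | right i => induction j using Fin.addCases <;> simp [appendCol]

theorem appendCol_injective {m : ℕ} {F : Type*} [Field F] :
    Function.Injective fun p : Matrix (Fin m) (Fin m) F × (Fin m → F) =>
      appendCol p.1 p.2 := by
  rintro ⟨B, v⟩ ⟨B', v'⟩ h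
  have h' := Matrix.fromBlocks_inj.1 ((Matrix.reindex finSumFinEquiv finSumFinEquiv).injective h)
  rw [Matrix.replicateCol_inj] at h'
  exact Prod.ext h'.1 h'.2.1

theorem StrictUpper.exists_appendCol {m : ℕ} {F : Type*} [Field F]
    {A : Matrix (Fin (m + 1)) (Fin (m + 1)) F} (hA : StrictUpper A) :
    ∃ B v, appendCol B v = A := by
  refine ⟨Matrix.of fun i j => A (Fin.castAdd 1 i) (Fin.castAdd 1 j),
    fun i => A (Fin.castAdd 1 i) (Fin.natAdd m 0), ?_⟩
  ext i j
  induction i using Fin.addCases with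
  | left i =>
    induction j using Fin.addCases with
    | left j => simp [appendCol]
    | right j =>
      rw [Subsingleton.elim j 0]
      simp [appendCol]
  | right i =>
    rw [hA (Fin.natAdd m i) j (by simp only [Fin.val_natAdd]; omega)]
    induction j using Fin.addCases <;> simp [appendCol]

open Classical in
/-- The strictly upper triangular matrices whose powers have ranks `r`. -/
noncomputable def rankSeqMatrices (m : ℕ) (r : ℕ → ℕ) (F : Type*) [Field F] [Fintype F] :
    Finset (Matrix (Fin m) (Fin m) F) :=
  Finset.univ.filter fun A => StrictUpper A ∧ ∀ k, (A ^ k).rank = r k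

theorem mem_rankSeqMatrices {m : ℕ} {r : ℕ → ℕ} {F : Type*} [Field F] [Fintype F]
    {A : Matrix (Fin m) (Fin m) F} :
    A ∈ rankSeqMatrices m r F ↔ StrictUpper A ∧ ∀ k, (A ^ k).rank = r k := by
  simp [rankSeqMatrices]

/-- Lower the ranks `r 0, …, r j` by one. -/
def lowerRanks (r : ℕ → ℕ) (j k : ℕ) : ℕ := r k - if k ≤ j then 1 else 0

open Classical in
theorem card_rankSeqMatrices_succ (m : ℕ) (r : ℕ → ℕ) (F : Type*) [Field F] [Fintype F] :
    ((rankSeqMatrices (m + 1) r F).card : ℤ) =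
      ∑ j ∈ Finset.range (m + 1), if ∀ k ≤ j, 1 ≤ r k then
        ((rankSeqMatrices m (lowerRanks r j) F).card : ℤ) *
          (returnPoly m (lowerRanks r j) j).eval (Fintype.card F : ℤ) else 0 := by
  let S : ℕ → Finset (Matrix (Fin m) (Fin m) F × (Fin m → F)) := fun j =>
    Finset.univ.filter fun p =>
      (∀ k ≤ j, 1 ≤ r k) ∧ p.1 ∈ rankSeqMatrices m (lowerRanks r j) F ∧ returnTime p.1 p.2 = j
  have himage : rankSeqMatrices (m + 1) r F =
      ((Finset.range (m + 1)).biUnion S).image fun p => appendCol p.1 p.2 := by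
    ext A
    simp only [Finset.mem_image, Finset.mem_biUnion, Finset.mem_range, S, Finset.mem_filter,
      Finset.mem_univ, true_and, mem_rankSeqMatrices, Prod.exists]
    constructor
    · rintro ⟨hA, hr⟩
      obtain ⟨B, v, rfl⟩ := hA.exists_appendCol
      have hB := strictUpper_appendCol.1 hA
      refine ⟨B, v, ⟨returnTime B v, Nat.lt_succ_of_le
        ((hB.returnTime_le_iff v m).2 (hB.mem_returnSpace v)), ?_, ⟨hB, ?_⟩, rfl⟩, rfl⟩
      · intro k hk
        rw [← hr k, hB.rank_appendCol_pow, if_pos hk]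
        omega
      · intro k
        rw [lowerRanks, ← hr k, hB.rank_appendCol_pow]
        omega
    · rintro ⟨B, v, ⟨j, -, hpos, ⟨hB, hr⟩, rfl⟩, rfl⟩
      refine ⟨strictUpper_appendCol.2 hB, fun k => ?_⟩
      have := hpos k
      rw [hB.rank_appendCol_pow, hr k, lowerRanks]
      split_ifs with hk
      · have := hpos k hk
        omega
      · rfl
  have hdisj : ∀ i ∈ Finset.range (m + 1), ∀ j ∈ Finset.range (m + 1), i ≠ j →
      Disjoint (S i) (S j) := by
    intro i _ j _ hij
    rw [Finset.disjoint_filter]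
    rintro p - ⟨-, -, rfl⟩ ⟨-, -, h⟩
    exact hij h
  rw [himage, Finset.card_image_of_injective _ appendCol_injective, Finset.card_biUnion hdisj]
  push_cast
  refine Finset.sum_congr rfl fun j _ => ?_
  split_ifs with hpos
  · rw [Finset.card_eq_sum_card_fiberwise (f := Prod.fst)
      (t := rankSeqMatrices m (lowerRanks r j) F)
      (fun p hp => (Finset.mem_filter.1 hp).2.2.1)]
    push_cast
    rw [← nsmul_eq_mul]
    refine Finset.sum_eq_card_nsmul fun B hB => ?_
    obtain ⟨hB', hr⟩ := mem_rankSeqMatrices.1 hB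
    rw [show lowerRanks r j = fun k => (B ^ k).rank from funext fun k => (hr k).symm,
      ← hB'.card_returnTime_eq]
    congr 1
    refine Finset.card_bij' (fun p _ => p.2) (fun v _ => (B, v)) ?_ ?_ ?_ ?_
    · rintro ⟨B', v⟩ hp
      simp only [S, Finset.mem_filter, Finset.mem_univ, true_and] at hp ⊢
      rw [← hp.2]
      exact hp.1.2.2
    · intro v hv
      simp only [S, Finset.mem_filter, Finset.mem_univ, true_and] at hv ⊢
      exact ⟨⟨hpos, hB, hv⟩, trivial⟩
    · rintro ⟨B', v⟩ hp
      exact Prod.ext (Finset.mem_filter.1 hp).2.symm rfl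
    · intros
      rfl
  · simp [S, hpos]

theorem exists_poly_card_rankSeqMatrices (m : ℕ) (r : ℕ → ℕ) :
    ∃ P : ℤ[X], ∀ (F : Type) [Field F] [Fintype F],
      ((rankSeqMatrices m r F).card : ℤ) = P.eval (Fintype.card F : ℤ) := by
  classical
  induction m generalizing r with
  | zero =>
    refine ⟨if ∀ k, r k = 0 then 1 else 0, fun F _ _ => ?_⟩
    have hrank : ∀ A : Matrix (Fin 0) (Fin 0) F, A.rank = 0 := fun A =>
      Nat.le_zero.1 (by simpa using A.rank_le_width)
    split_ifs with h
    · have : rankSeqMatrices 0 r F = Finset.univ := by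
        ext A
        simp [mem_rankSeqMatrices, hrank, h, StrictUpper]
      rw [this, Finset.card_univ, Fintype.card_eq_one_iff.2 ⟨0, fun A => Subsingleton.elim _ _⟩]
      simp
    · have : rankSeqMatrices 0 r F = ∅ := by
        ext A
        simp only [mem_rankSeqMatrices, hrank, Finset.notMem_empty, iff_false, not_and]
        exact fun _ h' => h fun k => (h' k).symm
      simp [this]
  | succ m ih =>
    choose P hP using ih
    refine ⟨∑ j ∈ Finset.range (m + 1), if ∀ k ≤ j, 1 ≤ r k then
      P (lowerRanks r j) * returnPoly m (lowerRanks r j) j else 0, fun F _ _ => ?_⟩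
    rw [card_rankSeqMatrices_succ, eval_finsetSum]
    refine Finset.sum_congr rfl fun j _ => ?_
    split_ifs
    · rw [hP, eval_mul]
    · simp

theorem jordan_type_count_is_polynomial (n N : ℕ) (hn : 0 < n) (f : ℕ → ℕ)
    (hf : IsPartitionFun f n N) :
    ∃ P : Polynomial ℤ, ∀ (F : Type) [Field F] [Fintype F],
      (jordanCount n f N F : ℤ) = P.eval (Fintype.card F : ℤ) := by
  classical
  obtain ⟨P, hP⟩ := exists_poly_card_rankSeqMatrices n fun k => ∑ i ∈ Finset.Icc 1 N, (f i - k)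
  refine ⟨P, fun F _ _ => ?_⟩
  rw [← hP F, jordanCount, Nat.card_eq_fintype_card, Fintype.card_subtype]
  congr 2
end

section
/- Let λ be a partition of n ≥ 2 with removable cells (i₁,i'₁),…,(i_s,i'_s). Then for every finite field F of order q, P_λ(F) = Σ_{j=1}^{s} (q^{n−λ'_{i'_j}} − q^{n−1−λ'_{i'_j−1}}) · P_{λ↓_j}(F), with the convention that the term q^{n−1−λ'_{i'_j−1}} is replaced by 0 when i'_j = 1 (the convention λ'_0 = ∞). -/
open Polynomial

section Bordered

variable {F : Type*} [Field F] {m : ℕ}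

/-- The matrix `B` extended by the last column `v` and a zero last row. -/
def borderedMatrix (B : Matrix (Fin m) (Fin m) F) (v : Fin m → F) :
    Matrix (Fin (m + 1)) (Fin (m + 1)) F :=
  (Matrix.fromBlocks B (Matrix.replicateCol (Fin 1) v) 0 0).submatrix
    finSumFinEquiv.symm finSumFinEquiv.symm

@[simp] lemma borderedMatrix_castSucc_castSucc (B : Matrix (Fin m) (Fin m) F) (v : Fin m → F)
    (i j : Fin m) : borderedMatrix B v i.castSucc j.castSucc = B i j := by
  change Matrix.fromBlocks _ _ _ _ (finSumFinEquiv.symm (Fin.castAdd 1 i))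
    (finSumFinEquiv.symm (Fin.castAdd 1 j)) = _
  simp only [finSumFinEquiv_symm_apply_castAdd, Matrix.fromBlocks_apply₁₁]

@[simp] lemma borderedMatrix_castSucc_last (B : Matrix (Fin m) (Fin m) F) (v : Fin m → F)
    (i : Fin m) : borderedMatrix B v i.castSucc (Fin.last m) = v i := by
  change Matrix.fromBlocks _ _ _ _ (finSumFinEquiv.symm (Fin.castAdd 1 i))
    (finSumFinEquiv.symm (Fin.last m)) = _
  simp only [finSumFinEquiv_symm_apply_castAdd, finSumFinEquiv_symm_last,
    Matrix.fromBlocks_apply₁₂, Matrix.replicateCol_apply]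

@[simp] lemma borderedMatrix_last (B : Matrix (Fin m) (Fin m) F) (v : Fin m → F)
    (j : Fin (m + 1)) : borderedMatrix B v (Fin.last m) j = 0 := by
  rw [borderedMatrix, Matrix.submatrix_apply, finSumFinEquiv_symm_last]
  rcases finSumFinEquiv.symm j with j | j <;> simp

lemma strictUpper_borderedMatrix (B : Matrix (Fin m) (Fin m) F) (v : Fin m → F) :
    StrictUpper (borderedMatrix B v) ↔ StrictUpper B := by
  constructor
  · intro h i j hij
    simpa using h i.castSucc j.castSucc (by simpa using hij)
  · intro h i j hij
    induction i using Fin.lastCases with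
    | last => simp
    | cast i =>
      induction j using Fin.lastCases with
      | last => simp at hij; omega
      | cast j => simpa using h i j (by simpa using hij)

lemma eq_borderedMatrix_of_strictUpper {A : Matrix (Fin (m + 1)) (Fin (m + 1)) F}
    (hA : StrictUpper A) :
    A = borderedMatrix (A.submatrix Fin.castSucc Fin.castSucc)
      (fun i => A i.castSucc (Fin.last m)) := by
  ext i j
  induction i using Fin.lastCases with
  | last => simpa using hA _ _ (by simpa using j.is_le)
  | cast i =>
    induction j using Fin.lastCases with
    | last => simp
    | cast j => simp

lemma borderedMatrix_pow_succ (B : Matrix (Fin m) (Fin m) F) (v : Fin m → F) (k : ℕ) :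
    borderedMatrix B v ^ (k + 1) = borderedMatrix (B ^ (k + 1)) ((B ^ k).mulVec v) := by
  induction k with
  | zero => simp
  | succ k ih =>
    rw [pow_succ', ih, borderedMatrix, borderedMatrix, Matrix.submatrix_mul_equiv,
      Matrix.fromBlocks_multiply, borderedMatrix]
    congr 2
    · simp [pow_succ']
    · ext i j
      simp [pow_succ' B k, ← Matrix.mulVec_mulVec, Matrix.mul_apply, Matrix.mulVec, dotProduct]
    · simp
    · simp

lemma rank_borderedMatrix (B : Matrix (Fin m) (Fin m) F) (v : Fin m → F) :
    (borderedMatrix B v).rank =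
      Module.finrank F ↥(LinearMap.range B.mulVecLin ⊔ Submodule.span F {v}) := by
  set M := Matrix.fromCols B (Matrix.replicateCol (Fin 1) v) with hM
  have h1 : (borderedMatrix B v).rank = M.rank := by
    rw [borderedMatrix, Matrix.rank_submatrix]
    have e : Matrix.fromBlocks B (Matrix.replicateCol (Fin 1) v) 0 0 =
        Matrix.fromRows M (0 : Matrix (Fin 1) (Fin m ⊕ Fin 1) F) := by
      ext (i | i) (j | j) <;> simp [hM]
    rw [e]
    apply le_antisymm
    · have := Matrix.rank_mul_le_right
        (Matrix.fromRows (1 : Matrix (Fin m) (Fin m) F) (0 : Matrix (Fin 1) (Fin m) F)) M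
      simpa [Matrix.fromRows_mul] using this
    · have := Matrix.rank_mul_le_right
        (Matrix.fromCols (1 : Matrix (Fin m) (Fin m) F) (0 : Matrix (Fin m) (Fin 1) F))
        (Matrix.fromRows M (0 : Matrix (Fin 1) (Fin m ⊕ Fin 1) F))
      simpa [Matrix.fromCols_mul_fromRows] using this
  rw [h1, Matrix.rank_eq_finrank_span_cols, Matrix.range_mulVecLin, ← Submodule.span_union]
  have hcols : Set.range M.col = Set.range B.col ∪ {v} := by
    ext w
    constructor
    · rintro ⟨j | j, rfl⟩
      · exact Or.inl ⟨j, rfl⟩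
      · exact Or.inr rfl
    · rintro (⟨j, rfl⟩ | rfl)
      · exact ⟨Sum.inl j, rfl⟩
      · exact ⟨Sum.inr 0, rfl⟩
  rw [hcols]

/-- The subspace `im B + ker B ^ k`. -/
def rangeSupKerPow (B : Matrix (Fin m) (Fin m) F) (k : ℕ) : Submodule F (Fin m → F) :=
  LinearMap.range B.mulVecLin ⊔ LinearMap.ker (B ^ k).mulVecLin

lemma mulVecLin_pow_succ (B : Matrix (Fin m) (Fin m) F) (k : ℕ) :
    (B ^ (k + 1)).mulVecLin = (B ^ k).mulVecLin ∘ₗ B.mulVecLin := by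
  rw [pow_succ, Matrix.mulVecLin_mul]

lemma rangeSupKerPow_mono (B : Matrix (Fin m) (Fin m) F) : Monotone (rangeSupKerPow B) := by
  refine monotone_nat_of_le_succ fun k => sup_le_sup_left (fun x hx => ?_) _
  rw [LinearMap.mem_ker, Matrix.mulVecLin_apply] at hx ⊢
  rw [pow_succ', ← Matrix.mulVec_mulVec, hx, Matrix.mulVec_zero]

lemma comap_range_pow_succ (B : Matrix (Fin m) (Fin m) F) (k : ℕ) :
    (LinearMap.range (B ^ (k + 1)).mulVecLin).comap (B ^ k).mulVecLin = rangeSupKerPow B k := by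
  rw [mulVecLin_pow_succ, LinearMap.range_comp, Submodule.comap_map_eq, rangeSupKerPow]

lemma pow_mulVec_mem_range_iff (B : Matrix (Fin m) (Fin m) F) (v : Fin m → F) (k : ℕ) :
    (B ^ k).mulVec v ∈ LinearMap.range (B ^ (k + 1)).mulVecLin ↔ v ∈ rangeSupKerPow B k := by
  rw [← comap_range_pow_succ, Submodule.mem_comap, Matrix.mulVecLin_apply]

lemma finrank_rangeSupKerPow_add_rank (B : Matrix (Fin m) (Fin m) F) (k : ℕ) :
    Module.finrank F (rangeSupKerPow B k) + (B ^ k).rank = m + (B ^ (k + 1)).rank := by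
  have hmap : (rangeSupKerPow B k).map (B ^ k).mulVecLin =
      LinearMap.range (B ^ (k + 1)).mulVecLin := by
    rw [← comap_range_pow_succ, Submodule.map_comap_eq, inf_eq_right, mulVecLin_pow_succ]
    exact LinearMap.range_comp_le_range _ _
  have h1 := LinearMap.finrank_range_add_finrank_ker
    ((B ^ k).mulVecLin.domRestrict (rangeSupKerPow B k))
  have h2 := LinearMap.finrank_range_add_finrank_ker (B ^ k).mulVecLin
  rw [LinearMap.range_domRestrict, hmap, LinearMap.ker_domRestrict,
    (Submodule.comapSubtypeEquivOfLe
      (show LinearMap.ker (B ^ k).mulVecLin ≤ rangeSupKerPow B k from le_sup_right)).finrank_eq]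
    at h1
  rw [Module.finrank_fin_fun] at h2
  rw [Matrix.rank, Matrix.rank]
  omega

open Classical in
lemma rank_borderedMatrix_pow_succ (B : Matrix (Fin m) (Fin m) F) (v : Fin m → F) (k : ℕ) :
    (borderedMatrix B v ^ (k + 1)).rank =
      (B ^ (k + 1)).rank + if v ∈ rangeSupKerPow B k then 0 else 1 := by
  rw [borderedMatrix_pow_succ, rank_borderedMatrix]
  split_ifs with h
  · rw [← pow_mulVec_mem_range_iff] at h
    rw [sup_eq_left.2 ((Submodule.span_singleton_le_iff_mem _ _).2 h), Matrix.rank, add_zero]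
  · rw [← pow_mulVec_mem_range_iff] at h
    rw [Submodule.finrank_sup_span_singleton h, Matrix.rank]

/-- Bordering `B` by the last column `v` adds a cell in column `c` to its Jordan type: `c - 1` is
the least `k` with `v ∈ im B + ker B ^ k`. -/
def AddsCellInColumn (B : Matrix (Fin m) (Fin m) F) (c : ℕ) (v : Fin m → F) : Prop :=
  ∀ k, v ∈ rangeSupKerPow B k ↔ c ≤ k + 1

lemma rank_borderedMatrix_pow {B : Matrix (Fin m) (Fin m) F} {c : ℕ} (hc : 1 ≤ c)
    {v : Fin m → F} (h : AddsCellInColumn B c v) (k : ℕ) :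
    (borderedMatrix B v ^ k).rank = (B ^ k).rank + if k < c then 1 else 0 := by
  classical
  cases k with
  | zero => simp [Matrix.rank_one, Nat.lt_of_lt_of_le Nat.zero_lt_one hc]
  | succ k =>
    rw [rank_borderedMatrix_pow_succ, if_congr (h k) rfl rfl]
    split_ifs <;> omega

lemma addsCellInColumn_of_rank {B : Matrix (Fin m) (Fin m) F} {c : ℕ} {v : Fin m → F}
    (h : ∀ k, (borderedMatrix B v ^ k).rank = (B ^ k).rank + if k < c then 1 else 0) :
    AddsCellInColumn B c v := by
  classical
  intro k
  have := h (k + 1)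
  rw [rank_borderedMatrix_pow_succ] at this
  by_cases hv : v ∈ rangeSupKerPow B k <;> by_cases hk : k + 1 < c <;> simp_all

lemma exists_addsCellInColumn {B : Matrix (Fin m) (Fin m) F} {v : Fin m → F}
    (h : ∃ k, v ∈ rangeSupKerPow B k) : ∃ c, 1 ≤ c ∧ AddsCellInColumn B c v := by
  classical
  refine ⟨Nat.find h + 1, by omega, fun k => ?_⟩
  rw [Nat.add_le_add_iff_right]
  exact ⟨fun hk => Nat.find_min' h hk, fun hk => rangeSupKerPow_mono B hk (Nat.find_spec h)⟩

lemma card_addsCellInColumn [Fintype F] (B : Matrix (Fin m) (Fin m) F) {c : ℕ} (hc : 1 ≤ c) :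
    (Nat.card {v // AddsCellInColumn B c v} : ℤ) =
      (Fintype.card F : ℤ) ^ Module.finrank F (rangeSupKerPow B (c - 1)) -
        if c = 1 then 0 else (Fintype.card F : ℤ) ^ Module.finrank F (rangeSupKerPow B (c - 2)) := by
  have key (k : ℕ) : ((rangeSupKerPow B k : Set (Fin m → F)).ncard : ℤ) =
      (Fintype.card F : ℤ) ^ Module.finrank F (rangeSupKerPow B k) := by
    have := Module.natCard_eq_pow_finrank (K := F) (V := rangeSupKerPow B k)
    rw [Nat.card_eq_fintype_card (α := F)] at this
    exact_mod_cast this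
  have hmono := rangeSupKerPow_mono B
  change ((Set.ncard {v | AddsCellInColumn B c v} : ℕ) : ℤ) = _
  split_ifs with h1
  · subst h1
    rw [sub_zero, ← key]
    congr 2
    ext v
    exact ⟨fun h => (h 0).2 le_rfl, fun h k => ⟨fun _ => by omega, fun _ => hmono k.zero_le h⟩⟩
  · have hset : {v | AddsCellInColumn B c v} =
        (rangeSupKerPow B (c - 1) : Set (Fin m → F)) \ rangeSupKerPow B (c - 2) := by
      ext v
      constructor
      · intro h
        exact ⟨(h _).2 (by omega), fun h' => by have := (h _).1 h'; omega⟩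
      · rintro ⟨h, h'⟩ k
        refine ⟨fun hk => ?_, fun hk => hmono (by omega) h⟩
        by_contra hck
        exact h' (hmono (by omega) hk)
    rw [hset, ← key, ← key, eq_sub_iff_add_eq]
    exact_mod_cast Set.ncard_sdiff_add_ncard_of_subset (hmono (by omega)) (Set.toFinite _)

end Bordered

section Partitions

variable {f : ℕ → ℕ} {n N : ℕ}

lemma sum_sub_eq_sum_sub_succ_add_dualPart (f : ℕ → ℕ) (N k : ℕ) :
    ∑ i ∈ Finset.Icc 1 N, (f i - k) =
      ∑ i ∈ Finset.Icc 1 N, (f i - (k + 1)) + dualPart f N (k + 1) := by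
  rw [dualPart, Finset.card_filter, ← Finset.sum_add_distrib]
  refine Finset.sum_congr rfl fun i _ => ?_
  split_ifs <;> omega

lemma sum_sub_update {i : ℕ} (hi : i ∈ Finset.Icc 1 N) (k : ℕ) :
    ∑ j ∈ Finset.Icc 1 N, (f j - k) =
      ∑ j ∈ Finset.Icc 1 N, (Function.update f i (f i - 1) j - k) + if k < f i then 1 else 0 := by
  rw [← Finset.add_sum_erase _ _ hi, ← Finset.add_sum_erase _ _ hi,
    Finset.sum_congr rfl (g := fun j => Function.update f i (f i - 1) j - k)
      fun j hj => by rw [Function.update_of_ne (Finset.ne_of_mem_erase hj)],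
    Function.update_self]
  split_ifs <;> omega

lemma sum_sub_removeCell (hf : IsPartitionFun f n N) {i : ℕ} (hi : i ∈ removables f N) (k : ℕ) :
    ∑ j ∈ Finset.Icc 1 N, (f j - k) =
      ∑ j ∈ Finset.Icc 1 (if f i = 1 then N - 1 else N), (Function.update f i (f i - 1) j - k) +
        if k < f i then 1 else 0 := by
  obtain ⟨hiN, hlt⟩ := Finset.mem_filter.1 hi
  rw [sum_sub_update hiN]
  congr 1
  split_ifs with h1
  · rw [Finset.mem_Icc] at hiN
    have hi_eq : i = N := by
      have := hf.2.1 (i + 1) (by omega)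
      omega
    refine (Finset.sum_subset (Finset.Icc_subset_Icc_right (Nat.sub_le N 1)) ?_).symm
    intro j hj hj'
    rw [Finset.mem_Icc] at hj hj'
    have : j = i := by omega
    subst this
    simp [h1]
  · rfl

lemma removables_injOn (hf : IsPartitionFun f n N) : Set.InjOn f (removables f N) := by
  intro i hi j hj hij
  obtain ⟨-, hi⟩ := Finset.mem_filter.1 hi
  obtain ⟨-, hj⟩ := Finset.mem_filter.1 hj
  rcases lt_trichotomy i j with h | h | h
  · have := hf.1 (i + 1) j h
    omega
  · exact h
  · have := hf.1 (j + 1) i h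
    omega

lemma exists_mem_removables (hf : IsPartitionFun f n N) {c : ℕ}
    (hlt : dualPart f N (c + 1) < dualPart f N c) : ∃ i ∈ removables f N, f i = c := by
  set S := (Finset.Icc 1 N).filter fun i => f i = c with hS
  have hne : S.Nonempty := by
    by_contra h
    rw [Finset.not_nonempty_iff_eq_empty, hS, Finset.filter_eq_empty_iff] at h
    refine hlt.ne (congrArg Finset.card (Finset.filter_congr fun i hi => ?_))
    have := h hi
    omega
  obtain ⟨hmem, hmax⟩ := Finset.mem_filter.1 (S.max'_mem hne)
  set i := S.max' hne with hi
  refine ⟨i, Finset.mem_filter.2 ⟨hmem, ?_⟩, hmax⟩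
  refine lt_of_le_of_ne (hf.1 _ _ i.le_succ) fun heq => ?_
  rw [Finset.mem_Icc] at hmem
  have h1 := hf.2.1 (i + 1) (by omega)
  have h2 := hf.2.1 i hmem.1
  have h3 := S.le_max' (i + 1)
    (Finset.mem_filter.2 ⟨Finset.mem_Icc.2 ⟨by omega, by omega⟩, heq.trans hmax⟩)
  omega

end Partitions

section Counting

variable {F : Type*} [Field F] {m N : ℕ} {f : ℕ → ℕ}

lemma hasJordanType_removeCell_iff {n : ℕ} (hf : IsPartitionFun f n N) {i : ℕ}
    (hi : i ∈ removables f N) (B : Matrix (Fin m) (Fin m) F) :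
    HasJordanType B (Function.update f i (f i - 1)) (if f i = 1 then N - 1 else N) ↔
      ∀ k, ∑ j ∈ Finset.Icc 1 N, (f j - k) = (B ^ k).rank + if k < f i then 1 else 0 := by
  refine forall_congr' fun k => ?_
  rw [sum_sub_removeCell hf hi k]
  omega

lemma pos_of_mem_removables {i : ℕ} (hi : i ∈ removables f N) : 1 ≤ f i := by
  have := (Finset.mem_filter.1 hi).2
  omega

/-- The last column of a bordered matrix of Jordan type `λ` adds a removable cell of `λ`. -/
lemma exists_removable_of_hasJordanType {n : ℕ} (hf : IsPartitionFun f n N)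
    {B : Matrix (Fin m) (Fin m) F} {v : Fin m → F}
    (h : HasJordanType (borderedMatrix B v) f N) :
    ∃ i ∈ removables f N, AddsCellInColumn B (f i) v ∧
      HasJordanType B (Function.update f i (f i - 1)) (if f i = 1 then N - 1 else N) := by
  classical
  have hex : ∃ k, v ∈ rangeSupKerPow B k := by
    refine ⟨f 0, ?_⟩
    have h0 := h (f 0 + 1)
    rw [Finset.sum_eq_zero fun i _ => by have := hf.1 0 i i.zero_le; omega,
      rank_borderedMatrix_pow_succ] at h0
    by_contra hv
    rw [if_neg hv] at h0
    omega
  obtain ⟨c, hc, hv⟩ := exists_addsCellInColumn hex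
  have hrank (k : ℕ) := (h k).symm.trans (rank_borderedMatrix_pow hc hv k)
  have hlt : dualPart f N (c + 1) < dualPart f N c := by
    obtain ⟨d, rfl⟩ : ∃ d, c = d + 1 := ⟨c - 1, by omega⟩
    have e1 := sum_sub_eq_sum_sub_succ_add_dualPart f N d
    have e2 := sum_sub_eq_sum_sub_succ_add_dualPart f N (d + 1)
    rw [hrank, hrank, if_pos (by omega), if_neg (by omega)] at e1
    rw [hrank, hrank, if_neg (by omega), if_neg (by omega)] at e2
    have d1 := finrank_rangeSupKerPow_add_rank B d
    have d2 := finrank_rangeSupKerPow_add_rank B (d + 1)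
    have := Submodule.finrank_mono (rangeSupKerPow_mono B (Nat.le_add_right d 1))
    omega
  obtain ⟨i, hi, rfl⟩ := exists_mem_removables hf hlt
  exact ⟨i, hi, hv, (hasJordanType_removeCell_iff hf hi B).2 hrank⟩

lemma hasJordanType_borderedMatrix_iff {n : ℕ} (hf : IsPartitionFun f n N) {i : ℕ}
    (hi : i ∈ removables f N) {B : Matrix (Fin m) (Fin m) F}
    (hB : HasJordanType B (Function.update f i (f i - 1)) (if f i = 1 then N - 1 else N))
    (v : Fin m → F) :
    HasJordanType (borderedMatrix B v) f N ↔ AddsCellInColumn B (f i) v := by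
  rw [hasJordanType_removeCell_iff hf hi] at hB
  constructor
  · exact fun h => addsCellInColumn_of_rank fun k => (h k).trans (hB k)
  · exact fun h k => (rank_borderedMatrix_pow (pos_of_mem_removables hi) h k).trans (hB k).symm

lemma removable_unique {n : ℕ} (hf : IsPartitionFun f n N) {i j : ℕ}
    (hi : i ∈ removables f N) (hj : j ∈ removables f N) {B : Matrix (Fin m) (Fin m) F}
    (hBi : HasJordanType B (Function.update f i (f i - 1)) (if f i = 1 then N - 1 else N))
    (hBj : HasJordanType B (Function.update f j (f j - 1)) (if f j = 1 then N - 1 else N)) :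
    i = j := by
  rw [hasJordanType_removeCell_iff hf hi] at hBi
  rw [hasJordanType_removeCell_iff hf hj] at hBj
  refine removables_injOn hf hi hj ?_
  have h1 := (hBi (f i)).symm.trans (hBj (f i))
  have h2 := (hBi (f j)).symm.trans (hBj (f j))
  split_ifs at h1 h2 <;> omega

/-- The number of ways to border a matrix of type `λ` minus a removable cell to type `λ`. -/
lemma card_borderings {n : ℕ} [Fintype F] (hf : IsPartitionFun f n N) {i : ℕ}
    (hi : i ∈ removables f N) {B : Matrix (Fin m) (Fin m) F}
    (hB : HasJordanType B (Function.update f i (f i - 1)) (if f i = 1 then N - 1 else N)) :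
    (Nat.card {v // HasJordanType (borderedMatrix B v) f N} : ℤ) =
      (Fintype.card F : ℤ) ^ (m + 1 - dualPart f N (f i)) -
        if f i = 1 then 0 else (Fintype.card F : ℤ) ^ (m - dualPart f N (f i - 1)) := by
  have hpos := pos_of_mem_removables hi
  simp_rw [hasJordanType_borderedMatrix_iff hf hi hB]
  rw [card_addsCellInColumn B hpos]
  rw [hasJordanType_removeCell_iff hf hi] at hB
  obtain ⟨d, hd⟩ : ∃ d, f i = d + 1 := ⟨f i - 1, by omega⟩
  rw [hd] at hB ⊢
  have e1 := sum_sub_eq_sum_sub_succ_add_dualPart f N d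
  rw [hB, hB, if_pos (by omega), if_neg (by omega)] at e1
  have d1 := finrank_rangeSupKerPow_add_rank B d
  congr 1
  · congr 1
    rw [Nat.add_sub_cancel]
    omega
  · cases d with
    | zero => simp
    | succ d =>
      have e2 := sum_sub_eq_sum_sub_succ_add_dualPart f N d
      rw [hB, hB, if_pos (by omega), if_pos (by omega)] at e2
      have d2 := finrank_rangeSupKerPow_add_rank B d
      rw [if_neg (by omega), if_neg (by omega)]
      congr 1
      rw [show d + 1 + 1 - 2 = d by omega, Nat.add_sub_cancel]
      omega

open Classical in
lemma jordanCount_succ (F : Type) [Field F] [Fintype F] (m N : ℕ) (f : ℕ → ℕ) :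
    jordanCount (m + 1) f N F =
      ∑ B : {B : Matrix (Fin m) (Fin m) F // StrictUpper B},
        Nat.card {v // HasJordanType (borderedMatrix B.1 v) f N} := by
  rw [← Nat.card_sigma, jordanCount]
  refine (Nat.card_congr (Equiv.ofBijective
    (fun p => ⟨borderedMatrix p.1.1 p.2.1,
      (strictUpper_borderedMatrix _ _).2 p.1.2, p.2.2⟩) ⟨?_, ?_⟩)).symm
  · rintro ⟨⟨B, hB⟩, ⟨v, hv⟩⟩ ⟨⟨C, hC⟩, ⟨w, hw⟩⟩ h
    have h' : borderedMatrix B v = borderedMatrix C w := congrArg Subtype.val h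
    obtain rfl : B = C := by
      ext i j
      simpa using congrFun (congrFun h' i.castSucc) j.castSucc
    obtain rfl : v = w := by
      ext i
      simpa using congrFun (congrFun h' i.castSucc) (Fin.last m)
    rfl
  · rintro ⟨A, hA, hJ⟩
    have e := eq_borderedMatrix_of_strictUpper hA
    refine ⟨⟨⟨A.submatrix Fin.castSucc Fin.castSucc,
      (strictUpper_borderedMatrix _ _).1 (e ▸ hA)⟩, ⟨_, e ▸ hJ⟩⟩, Subtype.ext e.symm⟩

open Classical in
lemma jordanCount_eq_sum (F : Type) [Field F] [Fintype F] (m N : ℕ) (f : ℕ → ℕ) :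
    (jordanCount m f N F : ℤ) =
      ∑ B : {B : Matrix (Fin m) (Fin m) F // StrictUpper B},
        if HasJordanType B.1 f N then 1 else 0 := by
  rw [Finset.sum_boole, ← Fintype.card_subtype, ← Nat.card_eq_fintype_card, jordanCount]
  exact congrArg _ (Nat.card_congr (Equiv.subtypeSubtypeEquivSubtypeInter _ _).symm)

end Counting

theorem P_recursion (n N : ℕ) (hn : 2 ≤ n) (f : ℕ → ℕ) (hf : IsPartitionFun f n N)
    (F : Type) [Field F] [Fintype F] :
    (jordanCount n f N F : ℤ) =
      ∑ i ∈ removables f N,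
        ((Fintype.card F : ℤ) ^ (n - dualPart f N (f i)) -
          if f i = 1 then 0 else (Fintype.card F : ℤ) ^ (n - 1 - dualPart f N (f i - 1))) *
        (jordanCount (n - 1) (Function.update f i (f i - 1))
          (if f i = 1 then N - 1 else N) F : ℤ) := by
  classical
  obtain ⟨m, rfl⟩ : ∃ m, n = m + 1 := ⟨n - 1, by omega⟩
  simp only [Nat.add_sub_cancel, jordanCount_eq_sum F m, Finset.mul_sum, mul_ite, mul_one,
    mul_zero]
  rw [jordanCount_succ, Nat.cast_sum, Finset.sum_comm]
  refine Finset.sum_congr rfl fun B _ => ?_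
  by_cases h : ∃ i ∈ removables f N,
      HasJordanType B.1 (Function.update f i (f i - 1)) (if f i = 1 then N - 1 else N)
  · obtain ⟨i, hi, hB⟩ := h
    rw [Finset.sum_eq_single_of_mem i hi fun j hj hji =>
      if_neg fun hBj => hji (removable_unique hf hj hi hBj hB), if_pos hB,
      card_borderings hf hi hB]
  · rw [Finset.sum_eq_zero fun i hi => if_neg fun hB => h ⟨i, hi, hB⟩]
    have : IsEmpty {v // HasJordanType (borderedMatrix B.1 v) f N} := by
      refine ⟨fun v => h ?_⟩
      obtain ⟨i, hi, -, hB⟩ := exists_removable_of_hasJordanType hf v.2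
      exact ⟨i, hi, hB⟩
    rw [Nat.card_of_isEmpty, Nat.cast_zero]
end

section
/- Let λ be a partition of n with N parts and let P_λ ∈ ℤ[x] be the polynomial such that P_λ(|F|) equals the number of strictly upper triangular n×n matrices over F of Jordan type λ for every finite field F. Then every coefficient of the polynomial P_λ(x)/(x−1)^{n−N} ∈ ℤ[x] is a nonnegative integer; consequently every coefficient of R_λ is a nonnegative integer. -/
open Polynomial

/-- The matrix `[A v; 0 0]`. -/
def addColumn {n : ℕ} {F : Type*} [Zero F] (A : Matrix (Fin n) (Fin n) F) (v : Fin n → F) :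
    Matrix (Fin (n + 1)) (Fin (n + 1)) F :=
  Matrix.of (Fin.snoc (α := fun _ => Fin (n + 1) → F)
    (fun i => Fin.snoc (α := fun _ => F) (A i) (v i)) 0)

section AddColumn

open scoped Matrix

variable {n : ℕ} {F : Type*}

@[simp] lemma addColumn_castSucc_castSucc [Zero F] (A : Matrix (Fin n) (Fin n) F) (v : Fin n → F)
    (i j : Fin n) : addColumn A v i.castSucc j.castSucc = A i j := by
  simp [addColumn]

@[simp] lemma addColumn_castSucc_last [Zero F] (A : Matrix (Fin n) (Fin n) F) (v : Fin n → F)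
    (i : Fin n) : addColumn A v i.castSucc (Fin.last n) = v i := by
  simp [addColumn]

@[simp] lemma addColumn_last [Zero F] (A : Matrix (Fin n) (Fin n) F) (v : Fin n → F)
    (j : Fin (n + 1)) : addColumn A v (Fin.last n) j = 0 := by
  simp [addColumn]

lemma strictUpper_addColumn [Zero F] {A : Matrix (Fin n) (Fin n) F} (hA : StrictUpper A)
    (v : Fin n → F) : StrictUpper (addColumn A v) := by
  intro i j
  refine Fin.lastCases ?_ (fun i => ?_) i
  · simp
  · refine Fin.lastCases ?_ (fun j => ?_) j
    · intro h
      have := i.2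
      simp at h
      omega
    · simpa using hA i j

/-- Strictly upper triangular matrices of size `n + 1` are the matrices `[A v; 0 0]`. -/
def strictUpperSuccEquiv (n : ℕ) (F : Type*) [Zero F] :
    {A : Matrix (Fin n) (Fin n) F // StrictUpper A} × (Fin n → F) ≃
      {M : Matrix (Fin (n + 1)) (Fin (n + 1)) F // StrictUpper M} where
  toFun p := ⟨addColumn p.1.1 p.2, strictUpper_addColumn p.1.2 p.2⟩
  invFun M := (⟨fun i j => M.1 i.castSucc j.castSucc, fun i j h => M.2 _ _ (by simpa using h)⟩,
    fun i => M.1 i.castSucc (Fin.last n))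
  left_inv p := by
    ext <;> simp
  right_inv M := by
    ext i j
    refine Fin.lastCases ?_ (fun i => ?_) i
    · exact (addColumn_last _ _ j).trans (M.2 (Fin.last n) j (by simpa using j.is_le)).symm
    · refine Fin.lastCases ?_ (fun j => ?_) j
      · exact addColumn_castSucc_last _ _ i
      · exact addColumn_castSucc_castSucc _ _ i j

lemma addColumn_mulVec_castSucc [CommRing F] (A : Matrix (Fin n) (Fin n) F) (v : Fin n → F)
    (w : Fin (n + 1) → F) (i : Fin n) :
    (addColumn A v *ᵥ w) i.castSucc = (A *ᵥ Fin.init w) i + w (Fin.last n) * v i := by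
  simp [Matrix.mulVec, dotProduct, Fin.sum_univ_castSucc, Fin.init, mul_comm]

lemma addColumn_mulVec_last [CommRing F] (A : Matrix (Fin n) (Fin n) F) (v : Fin n → F)
    (w : Fin (n + 1) → F) : (addColumn A v *ᵥ w) (Fin.last n) = 0 := by
  simp [Matrix.mulVec, dotProduct]

lemma addColumn_pow_succ_mulVec [CommRing F] (A : Matrix (Fin n) (Fin n) F) (v : Fin n → F)
    (k : ℕ) (w : Fin (n + 1) → F) :
    (addColumn A v ^ (k + 1)) *ᵥ w = Fin.snoc (α := fun _ => F)
      ((A ^ (k + 1)) *ᵥ Fin.init w + w (Fin.last n) • (A ^ k) *ᵥ v) 0 := by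
  induction k with
  | zero =>
    ext i
    refine Fin.lastCases ?_ (fun i => ?_) i
    · simp [addColumn_mulVec_last]
    · simp [addColumn_mulVec_castSucc]
  | succ k ih =>
    rw [pow_succ', ← Matrix.mulVec_mulVec, ih]
    ext i
    refine Fin.lastCases ?_ (fun i => ?_) i
    · simp [addColumn_mulVec_last]
    · rw [addColumn_mulVec_castSucc, Fin.init_snoc]
      simp only [Fin.snoc_last, Fin.snoc_castSucc, zero_mul, add_zero, Matrix.mulVec_add,
        Matrix.mulVec_smul, Matrix.mulVec_mulVec, ← pow_succ']

/-- Appending a zero coordinate, as a linear map. -/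
def snocZero (n : ℕ) (F : Type*) [Semiring F] : (Fin n → F) →ₗ[F] (Fin (n + 1) → F) where
  toFun x := Fin.snoc (α := fun _ => F) x 0
  map_add' x y := by
    ext i
    refine Fin.lastCases ?_ (fun i => ?_) i <;> simp
  map_smul' c x := by
    ext i
    refine Fin.lastCases ?_ (fun i => ?_) i <;> simp

lemma snocZero_injective (n : ℕ) (F : Type*) [Semiring F] :
    Function.Injective (snocZero n F) := fun x y h => by
  simpa using congrArg (Fin.init (α := fun _ => F)) (show
    Fin.snoc (α := fun _ => F) x 0 = Fin.snoc (α := fun _ => F) y 0 from h)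

lemma range_addColumn_pow_succ [CommRing F] (A : Matrix (Fin n) (Fin n) F) (v : Fin n → F)
    (k : ℕ) : LinearMap.range (addColumn A v ^ (k + 1)).mulVecLin =
      (LinearMap.range (A ^ (k + 1)).mulVecLin ⊔ Submodule.span F {(A ^ k) *ᵥ v}).map
        (snocZero n F) := by
  ext y
  simp only [LinearMap.mem_range, Matrix.mulVecLin_apply, Submodule.mem_map, Submodule.mem_sup,
    Submodule.mem_span_singleton, addColumn_pow_succ_mulVec]
  constructor
  · rintro ⟨w, rfl⟩
    exact ⟨_, ⟨_, ⟨_, rfl⟩, _, ⟨_, rfl⟩, rfl⟩, rfl⟩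
  · rintro ⟨_, ⟨_, ⟨x, rfl⟩, _, ⟨t, rfl⟩, rfl⟩, rfl⟩
    exact ⟨Fin.snoc (α := fun _ => F) x t, by simp [snocZero]⟩

/-- The vectors `v` with `A ^ k v` in the range of `A ^ (k + 1)`. -/
def absorbed [CommRing F] (A : Matrix (Fin n) (Fin n) F) (k : ℕ) : Submodule F (Fin n → F) :=
  (LinearMap.range (A ^ (k + 1)).mulVecLin).comap (A ^ k).mulVecLin

lemma mem_absorbed [CommRing F] {A : Matrix (Fin n) (Fin n) F} {k : ℕ} {v : Fin n → F} :
    v ∈ absorbed A k ↔ ∃ x, (A ^ (k + 1)) *ᵥ x = (A ^ k) *ᵥ v := by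
  simp [absorbed]

lemma absorbed_mono [CommRing F] (A : Matrix (Fin n) (Fin n) F) : Monotone (absorbed A) := by
  refine monotone_nat_of_le_succ fun k v hv => ?_
  rw [mem_absorbed] at hv ⊢
  obtain ⟨x, hx⟩ := hv
  refine ⟨x, ?_⟩
  rw [pow_succ' A (k + 1), ← Matrix.mulVec_mulVec, hx, Matrix.mulVec_mulVec, ← pow_succ']

lemma rank_addColumn_pow_succ [Field F] (A : Matrix (Fin n) (Fin n) F) (v : Fin n → F) (k : ℕ)
    [Decidable (v ∈ absorbed A k)] :
    (addColumn A v ^ (k + 1)).rank =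
      (A ^ (k + 1)).rank + if v ∈ absorbed A k then 0 else 1 := by
  rw [Matrix.rank, range_addColumn_pow_succ,
    ← (Submodule.equivMapOfInjective _ (snocZero_injective n F) _).finrank_eq]
  split_ifs with h
  · rw [sup_eq_left.2]
    · rfl
    · simpa [absorbed] using h
  · rw [Submodule.finrank_sup_span_singleton]
    · rfl
    · simpa [absorbed] using h

lemma finrank_absorbed_add_rank [Field F] (A : Matrix (Fin n) (Fin n) F) (k : ℕ) :
    Module.finrank F (absorbed A k) + (A ^ k).rank = n + (A ^ (k + 1)).rank := by
  have h₁ := ((A ^ k).mulVecLin.domRestrict (absorbed A k)).finrank_range_add_finrank_ker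
  have h₂ := (A ^ k).mulVecLin.finrank_range_add_finrank_ker
  have hle : LinearMap.ker (A ^ k).mulVecLin ≤ absorbed A k := fun v hv => by
    rw [LinearMap.mem_ker] at hv
    simp [absorbed, hv]
  have hker : LinearMap.ker ((A ^ k).mulVecLin.domRestrict (absorbed A k)) =
      (LinearMap.ker (A ^ k).mulVecLin).comap (absorbed A k).subtype := rfl
  have hrange : LinearMap.range ((A ^ k).mulVecLin.domRestrict (absorbed A k)) =
      LinearMap.range (A ^ (k + 1)).mulVecLin := by
    rw [LinearMap.range_domRestrict, absorbed, Submodule.map_comap_eq, inf_eq_right,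
      pow_succ, Matrix.mulVecLin_mul]
    exact LinearMap.range_comp_le_range _ _
  rw [hker, hrange, (Submodule.comapSubtypeEquivOfLe hle).finrank_eq] at h₁
  rw [Module.finrank_fin_fun] at h₂
  simp only [Matrix.rank]
  omega

lemma StrictUpper.pow_eq_zero_s5 [CommRing F] {A : Matrix (Fin n) (Fin n) F} (hA : StrictUpper A) :
    A ^ n = 0 := by
  have h := A.aeval_self_charpoly
  rw [Matrix.charpoly_of_isUpperTriangular A (fun i j hij => hA i j (le_of_lt hij))] at h
  simpa [hA _ _ le_rfl] using h

/-- `c` is the first index `k` with `A ^ k v` in the range of `A ^ (k + 1)`. -/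
def IsJump [CommRing F] (A : Matrix (Fin n) (Fin n) F) (c : ℕ) (v : Fin n → F) : Prop :=
  ∀ k, v ∈ absorbed A k ↔ c ≤ k

lemma existsUnique_isJump [CommRing F] {A : Matrix (Fin n) (Fin n) F} (hA : StrictUpper A)
    (v : Fin n → F) : ∃! c : Fin (n + 1), IsJump A c v := by
  classical
  have hn : v ∈ absorbed A n := by simp [mem_absorbed, hA.pow_eq_zero_s5, pow_succ]
  have hex : ∃ k, v ∈ absorbed A k := ⟨n, hn⟩
  refine ⟨⟨Nat.find hex, Nat.lt_succ_of_le (Nat.find_min' hex hn)⟩, fun k => ⟨fun h =>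
    Nat.find_min' hex h, fun h => absorbed_mono A h (Nat.find_spec hex)⟩, fun c hc => ?_⟩
  refine Fin.ext (le_antisymm ((hc _).1 (Nat.find_spec hex)) (Nat.find_min' hex ((hc _).2 le_rfl)))

lemma isJump_zero [CommRing F] {A : Matrix (Fin n) (Fin n) F} {v : Fin n → F} :
    IsJump A 0 v ↔ v ∈ absorbed A 0 :=
  ⟨fun h => (h 0).2 le_rfl, fun h k => by simpa using absorbed_mono A (Nat.zero_le k) h⟩

lemma isJump_succ [CommRing F] {A : Matrix (Fin n) (Fin n) F} {v : Fin n → F} {c : ℕ} :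
    IsJump A (c + 1) v ↔ v ∈ absorbed A (c + 1) ∧ v ∉ absorbed A c := by
  refine ⟨fun h => ⟨(h _).2 le_rfl, fun h' => by simpa using (h c).1 h'⟩, fun h k => ⟨fun hk => ?_,
    fun hk => absorbed_mono A hk h.1⟩⟩
  by_contra! hlt
  exact h.2 (absorbed_mono A (Nat.lt_succ_iff.1 hlt) hk)

lemma natCard_absorbed [Field F] [Fintype F] (A : Matrix (Fin n) (Fin n) F) (k : ℕ) :
    Nat.card (absorbed A k) = Fintype.card F ^ (n + (A ^ (k + 1)).rank - (A ^ k).rank) := by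
  rw [Module.natCard_eq_pow_finrank (K := F), Nat.card_eq_fintype_card,
    ← finrank_absorbed_add_rank, Nat.add_sub_cancel]

end AddColumn

/-- For a matrix of size `n` over a field with `q` elements whose `k`-th power has rank `s k`, the
number of vectors with jump `c` is the value of this polynomial at `q`, multiplied by `q - 1`
if `0 < c`. -/
noncomputable def jumpPoly (n : ℕ) (s : ℕ → ℕ) : ℕ → ℕ[X]
  | 0 => X ^ (n + s 1 - s 0)
  | c + 1 => X ^ (n + s (c + 1) - s c) *
      ∑ i ∈ Finset.range ((n + s (c + 2) - s (c + 1)) - (n + s (c + 1) - s c)), X ^ i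

lemma natCard_isJump {n : ℕ} {F : Type*} [Field F] [Fintype F] (A : Matrix (Fin n) (Fin n) F)
    (s : ℕ → ℕ) (hs : ∀ k, (A ^ k).rank = s k) (c : ℕ) :
    Nat.card {v // IsJump A c v} =
      (Fintype.card F - 1) ^ min c 1 * (jumpPoly n s c).eval (Fintype.card F) := by
  have hcard (k : ℕ) : (absorbed A k : Set (Fin n → F)).ncard =
      Fintype.card F ^ (n + s (k + 1) - s k) := by
    rw [← hs, ← hs, ← natCard_absorbed]
    rfl
  cases c with
  | zero =>
    simp only [isJump_zero, jumpPoly, eval_pow, eval_X, Nat.zero_min, pow_zero, one_mul]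
    exact hcard 0
  | succ c =>
    have hle : absorbed A c ≤ absorbed A (c + 1) := absorbed_mono A c.le_succ
    have hset : {v | IsJump A (c + 1) v} =
        (absorbed A (c + 1) : Set (Fin n → F)) \ absorbed A c := by
      ext v
      exact isJump_succ
    have h := Set.ncard_sdiff (s := (absorbed A c : Set (Fin n → F))) hle (Set.toFinite _)
    rw [← hset, hcard, hcard] at h
    have hexp : n + s (c + 1) - s c ≤ n + s (c + 2) - s (c + 1) := by
      rw [← Nat.pow_le_pow_iff_right (Fintype.one_lt_card (α := F)), ← hcard, ← hcard]
      exact Set.ncard_le_ncard hle (Set.toFinite _)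
    refine h.trans ?_
    obtain ⟨d, hd⟩ := Nat.exists_eq_add_of_le hexp
    rw [jumpPoly, hd, Nat.add_sub_cancel_left]
    simp only [eval_mul, eval_pow, eval_X, eval_finsetSum]
    zify [Fintype.card_pos (α := F), Nat.pow_le_pow_right (Fintype.card_pos (α := F))
      (Nat.le_add_right (n + s (c + 1) - s c) d)]
    have hg := mul_geom_sum (Fintype.card F : ℤ) d
    simp only [Nat.le_add_left, inf_of_le_right, pow_one, pow_add]
    linear_combination (-(Fintype.card F : ℤ) ^ (n + s (c + 1) - s c)) * hg

/-- The number of strictly upper triangular matrices of size `n` whose `k`-th power has rank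
`r k`. -/
noncomputable def rankCount (n : ℕ) (r : ℕ → ℕ) (F : Type*) [Field F] : ℕ :=
  Nat.card {A : Matrix (Fin n) (Fin n) F // StrictUpper A ∧ ∀ k, (A ^ k).rank = r k}

lemma rankCount_succ (n : ℕ) (r : ℕ → ℕ) (F : Type*) [Field F] [Fintype F] :
    rankCount (n + 1) r F = ∑ c : Fin (n + 1), Nat.card
      {p : {A : Matrix (Fin n) (Fin n) F // StrictUpper A} × (Fin n → F) //
        IsJump p.1.1 c p.2 ∧ ∀ k, (addColumn p.1.1 p.2 ^ k).rank = r k} := by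
  classical
  let S := {p : {A : Matrix (Fin n) (Fin n) F // StrictUpper A} × (Fin n → F) //
    ∀ k, (addColumn p.1.1 p.2 ^ k).rank = r k}
  have e₁ : {M : Matrix (Fin (n + 1)) (Fin (n + 1)) F // StrictUpper M ∧
      ∀ k, (M ^ k).rank = r k} ≃ S :=
    (Equiv.subtypeSubtypeEquivSubtypeInter _ _).symm.trans
      ((strictUpperSuccEquiv n F).subtypeEquiv fun _ => Iff.rfl).symm
  choose c hc hcu using fun p : S => existsUnique_isJump p.1.1.2 p.1.2
  rw [rankCount, Nat.card_congr e₁, Nat.card_congr (Equiv.sigmaFiberEquiv c).symm, Nat.card_sigma]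
  refine Finset.sum_congr rfl fun d _ => Nat.card_congr ?_
  refine (Equiv.subtypeEquivRight (q := fun p : S => IsJump p.1.1.1 d p.1.2) fun p =>
    ⟨fun h : c p = d => h ▸ hc p, fun h => (hcu p d h).symm⟩).trans ?_
  refine (Equiv.subtypeSubtypeEquivSubtypeInter _ (fun p : {A : Matrix (Fin n) (Fin n) F //
    StrictUpper A} × (Fin n → F) => IsJump p.1.1 d p.2)).trans ?_
  exact Equiv.subtypeEquivRight fun p => and_comm

/-- The ranks of the powers of `A` when those of `[A v; 0 0]` are `r` and `v` has jump `c`. -/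
def dropRank (n : ℕ) (r : ℕ → ℕ) (c : ℕ) : ℕ → ℕ
  | 0 => n
  | k + 1 => r (k + 1) - if k < c then 1 else 0

lemma rank_addColumn_pow_iff {n : ℕ} {F : Type*} [Field F] {A : Matrix (Fin n) (Fin n) F}
    {v : Fin n → F} {c : ℕ} (h : IsJump A c v) {r : ℕ → ℕ} :
    (∀ k, (addColumn A v ^ k).rank = r k) ↔
      (r 0 = n + 1 ∧ ∀ k < c, 0 < r (k + 1)) ∧ ∀ k, (A ^ k).rank = dropRank n r c k := by
  classical
  have hsucc (k : ℕ) : (addColumn A v ^ (k + 1)).rank =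
      (A ^ (k + 1)).rank + if k < c then 1 else 0 := by
    rw [rank_addColumn_pow_succ, h k]
    split_ifs <;> omega
  constructor
  · intro H
    have H' (k : ℕ) : (A ^ (k + 1)).rank + (if k < c then 1 else 0) = r (k + 1) :=
      (hsucc k).symm.trans (H (k + 1))
    refine ⟨⟨by simpa using (H 0).symm, fun k hk => ?_⟩, fun k => ?_⟩
    · have := H' k
      rw [if_pos hk] at this
      omega
    · cases k with
      | zero => simp [dropRank]
      | succ k => rw [dropRank, ← H' k, Nat.add_sub_cancel]
  · rintro ⟨⟨h0, hpos⟩, H⟩ k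
    cases k with
    | zero => simp [h0]
    | succ k =>
      rw [hsucc, H, dropRank]
      split_ifs with hk
      · exact Nat.sub_add_cancel (hpos k hk)
      · simp

/-- The number of strictly upper triangular matrices with prescribed ranks `r k` of the powers is
`(q - 1) ^ r 1` times the value at `q` of a polynomial with natural number coefficients. -/
theorem exists_rankCount_eq (n : ℕ) (r : ℕ → ℕ) :
    ∃ Q : ℕ[X], ∀ (F : Type) [Field F] [Fintype F],
      rankCount n r F = (Fintype.card F - 1) ^ r 1 * Q.eval (Fintype.card F) := by
  classical
  induction n generalizing r with
  | zero =>
    by_cases hr : r = 0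
    · refine ⟨1, fun F _ _ => ?_⟩
      have : Unique {A : Matrix (Fin 0) (Fin 0) F // StrictUpper A ∧ ∀ k, (A ^ k).rank = r k} :=
        { default := ⟨0, fun i => i.elim0, fun k => by
            simpa [hr] using ((0 : Matrix (Fin 0) (Fin 0) F) ^ k).rank_le_height⟩
          uniq := fun _ => Subsingleton.elim _ _ }
      simpa [rankCount, hr] using Nat.card_unique (α := {A : Matrix (Fin 0) (Fin 0) F //
        StrictUpper A ∧ ∀ k, (A ^ k).rank = r k})
    · refine ⟨0, fun F _ _ => ?_⟩
      have : IsEmpty {A : Matrix (Fin 0) (Fin 0) F // StrictUpper A ∧ ∀ k, (A ^ k).rank = r k} :=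
        ⟨fun A => hr <| funext fun k => by
          simpa [A.2.2 k] using (A.1 ^ k).rank_le_height⟩
      simp [rankCount]
  | succ n ih =>
    suffices h : ∀ c : Fin (n + 1), ∃ Q : ℕ[X], ∀ (F : Type) [Field F] [Fintype F], Nat.card
        {p : {A : Matrix (Fin n) (Fin n) F // StrictUpper A} × (Fin n → F) //
          IsJump p.1.1 c p.2 ∧ ∀ k, (addColumn p.1.1 p.2 ^ k).rank = r k} =
        (Fintype.card F - 1) ^ r 1 * Q.eval (Fintype.card F) by
      choose Q hQ using h
      exact ⟨∑ c, Q c, fun F _ _ => by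
        rw [rankCount_succ, eval_finsetSum, Finset.mul_sum]
        exact Finset.sum_congr rfl fun c _ => hQ c F⟩
    rintro ⟨c, -⟩
    by_cases hr : r 0 = n + 1 ∧ ∀ k < c, 0 < r (k + 1)
    · obtain ⟨Q, hQ⟩ := ih (dropRank n r c)
      refine ⟨jumpPoly n (dropRank n r c) c * Q, fun F _ _ => ?_⟩
      have hr₁ : r 1 = min c 1 + dropRank n r c 1 := by
        rw [dropRank]
        rcases c with _ | c
        · simp
        · have := hr.2 0 c.succ_pos
          simp at this ⊢
          omega
      have e : {p : {A : Matrix (Fin n) (Fin n) F // StrictUpper A} × (Fin n → F) //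
          IsJump p.1.1 c p.2 ∧ ∀ k, (addColumn p.1.1 p.2 ^ k).rank = r k} ≃
          Σ A : {A : Matrix (Fin n) (Fin n) F // StrictUpper A ∧
            ∀ k, (A ^ k).rank = dropRank n r c k}, {v // IsJump A.1 c v} :=
        { toFun p := ⟨⟨p.1.1.1, p.1.1.2, ((rank_addColumn_pow_iff p.2.1).1 p.2.2).2⟩,
            p.1.2, p.2.1⟩
          invFun p := ⟨(⟨p.1.1, p.1.2.1⟩, p.2.1), p.2.2,
            (rank_addColumn_pow_iff p.2.2).2 ⟨hr, p.1.2.2⟩⟩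
          left_inv _ := rfl
          right_inv _ := rfl }
      have := Fintype.ofFinite {A : Matrix (Fin n) (Fin n) F // StrictUpper A ∧
        ∀ k, (A ^ k).rank = dropRank n r c k}
      rw [Nat.card_congr e, Nat.card_sigma, Finset.sum_congr rfl fun A _ =>
        natCard_isJump A.1 (dropRank n r c) A.2.2 c, Finset.sum_const, Finset.card_univ,
        ← Nat.card_eq_fintype_card, ← rankCount, hQ, hr₁, eval_mul, pow_add, smul_eq_mul]
      ring
    · refine ⟨0, fun F _ _ => ?_⟩
      have : IsEmpty {p : {A : Matrix (Fin n) (Fin n) F // StrictUpper A} × (Fin n → F) //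
          IsJump p.1.1 c p.2 ∧ ∀ k, (addColumn p.1.1 p.2 ^ k).rank = r k} :=
        ⟨fun p => hr ((rank_addColumn_pow_iff p.2.1).1 p.2.2).1⟩
      simp

lemma IsPartitionFun.sum_sub_one {f : ℕ → ℕ} {n N : ℕ} (hf : IsPartitionFun f n N) :
    ∑ i ∈ Finset.Icc 1 N, (f i - 1) = n - N := by
  have h : ∑ i ∈ Finset.Icc 1 N, (f i - 1) + ∑ i ∈ Finset.Icc 1 N, 1 = n := by
    rw [← Finset.sum_add_distrib, ← hf.2.2]
    refine Finset.sum_congr rfl fun i hi => Nat.sub_add_cancel ?_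
    rw [Finset.mem_Icc] at hi
    exact (hf.2.1 i hi.1).2 hi.2
  simp at h
  omega

theorem coeffs_nonneg (n N : ℕ) (f : ℕ → ℕ) (hf : IsPartitionFun f n N)
    (P : Polynomial ℤ)
    (hP : ∀ (F : Type) [Field F] [Fintype F],
      (jordanCount n f N F : ℤ) = P.eval (Fintype.card F : ℤ))
    (Q : Polynomial ℤ) (hQ : P = (X - 1 : Polynomial ℤ) ^ (n - N) * Q) :
    ∀ k : ℕ, 0 ≤ Q.coeff k := by
  obtain ⟨R, hR⟩ := exists_rankCount_eq n fun k => ∑ i ∈ Finset.Icc 1 N, (f i - k)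
  have hPR : P = (X - 1) ^ (n - N) * R.map (Nat.castRingHom ℤ) := by
    refine eq_of_infinite_eval_eq _ _ (((Nat.infinite_setOfPred_prime.image
      (Nat.cast_injective (R := ℤ)).injOn)).mono ?_)
    rintro _ ⟨p, hp, rfl⟩
    have : Fact p.Prime := ⟨hp⟩
    have h := hP (ZMod p)
    rw [show jordanCount n f N (ZMod p) = _ from hR (ZMod p), hf.sum_sub_one, ZMod.card] at h
    have hcast : eval (p : ℤ) (R.map (Nat.castRingHom ℤ)) = (R.eval p : ℕ) := by
      simp
    rw [Set.mem_ofPred_eq, ← h]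
    simp [hcast, Nat.cast_sub hp.one_le]
  have hne : (X - 1 : ℤ[X]) ^ (n - N) ≠ 0 := pow_ne_zero _ (X_sub_C_ne_zero (1 : ℤ))
  have hQR : Q = R.map (Nat.castRingHom ℤ) := mul_left_cancel₀ hne (hQ.symm.trans hPR)
  intro k
  simp [hQR]
end
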